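/- Palm inversion formula: Let Y be a random element of ℝ₀^{ℤ^d} satisfying the tail-process identity with P(Y ∈ E₀) = 1, let A be an anchoring function, ϑ_A := P(A(Y) = 0) > 0, and let Z^A = (Z^A_i)_{i∈ℤ^d} be the anchored process, i.e. a random element with law P(Y ∈ · | A(Y) = 0). Then for every measurable h : E₀ → [0,∞): E[h(Y)] = ϑ_A Σ_{k∈ℤ^d} E[h(θ_k Z^A) 1{|Z^A_k| > 1}] = ϑ_A E[Σ_{k∈e(Z^A)} h(θ_k Z^A)]. -/

import Mathlib

open MeasureTheory ENNReal Filter ProbabilityTheory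

noncomputable section

/-- The space `ℝ^{ℤ^d}` of real-valued fields indexed by `ℤ^d`. -/
abbrev RField (d : ℕ) := (Fin d → ℤ) → ℝ

variable {d : ℕ}

/-- Shift operator: `shift k x = (x_{i+k})_i`, i.e. it moves the origin to `k`. -/
def shift (k : Fin d → ℤ) (x : RField d) : RField d := fun i => x (i + k)

/-- The set of exceedance-points of `x`. -/
def excSet (x : RField d) : Set (Fin d → ℤ) := {k | 1 < |x k|}

open Classical in
/-- Indicator (with values in `ℝ≥0∞`) of the event that `|x k| > s`. -/
def exIndGT (s : ℝ) (k : Fin d → ℤ) (x : RField d) : ℝ≥0∞ := if s < |x k| then 1 else 0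

/-- The tail-process identity:
`E[h(θ_k Y) 1{|Y_k| > 1}] = E[h(Y) 1{|Y_{−k}| > 1}]` for every measurable nonnegative `h`
and every `k ∈ ℤ^d`. -/
def TailIdentity {Ω : Type*} [MeasurableSpace Ω] (μ : Measure Ω) (Y : Ω → RField d) : Prop :=
  ∀ h : RField d → ℝ≥0∞, Measurable h → ∀ k : Fin d → ℤ,
    ∫⁻ ω, h (shift k (Y ω)) * exIndGT 1 k (Y ω) ∂μ
      = ∫⁻ ω, h (Y ω) * exIndGT 1 (-k) (Y ω) ∂μ

/-- `Y` is exceedance-stationary: for every exceedance-map `τ` which is bijective on a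
measurable set `B` (invariant under shifting the origin to exceedance-points, contained in
`ℝ₀^{ℤ^d}`) carrying the law of `Y`, we have `θ_τ Y ≐ Y`. -/
def ExcStationary {Ω : Type*} [MeasurableSpace Ω] (μ : Measure Ω) (Y : Ω → RField d) : Prop :=
  ∀ (B : Set (RField d)) (τ : RField d → Fin d → ℤ),
    MeasurableSet B → Measurable τ →
    (∀ x ∈ B, 1 < |x 0|) →
    (∀ x ∈ B, ∀ k ∈ excSet x, shift k x ∈ B) →
    (∀ x ∈ B, τ x ∈ excSet x) →
    (∀ x ∈ B, Set.BijOn (fun k => k + τ (shift k x)) (excSet x) (excSet x)) →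
    (∀ᵐ ω ∂μ, Y ω ∈ B) →
    Measure.map (fun ω => shift (τ (Y ω)) (Y ω)) μ = Measure.map Y μ

/-- `E₀`: elements of `ℝ₀^{ℤ^d}` with finitely many exceedance-points. -/
def E0set (d : ℕ) : Set (RField d) := {x | 1 < |x 0| ∧ (excSet x).Finite}

/-- `E`: elements of `ℝ^{ℤ^d}` with at least one but finitely many exceedance-points. -/
def Eset (d : ℕ) : Set (RField d) := {x | (excSet x).Nonempty ∧ (excSet x).Finite}

/-- `l₀`: fields vanishing at infinity. -/
def l0set (d : ℕ) : Set (RField d) := {x | Tendsto (fun i => |x i|) cofinite (nhds 0)}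

/-- Uniform norm `‖x‖ = sup_i |x_i|`. -/
def supNorm (x : RField d) : ℝ := ⨆ i, |x i|

/-- `V` is Pareto(α)-distributed: `P(V > y) = y^{-α}` for `y ≥ 1`. -/
def IsPareto {Ω : Type*} [MeasurableSpace Ω] (μ : Measure Ω) (V : Ω → ℝ) (α : ℝ) : Prop :=
  ∀ y : ℝ, 1 ≤ y → μ {ω | y < V ω} = ENNReal.ofReal (y ^ (-α))

/-- An anchoring function on `S`: a measurable shift-covariant exceedance-map. -/
def IsAnchoringOn (S : Set (RField d)) (A : RField d → Fin d → ℤ) : Prop :=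
  Measurable A ∧ ∀ x ∈ S, A x ∈ excSet x ∧ ∀ k ∈ excSet x, A (shift k x) + k = A x

/-- `h` is shift-invariant on `S`. -/
def ShiftInvariantOn (S : Set (RField d)) (h : RField d → ℝ≥0∞) : Prop :=
  ∀ x ∈ S, ∀ k : Fin d → ℤ, h (shift k x) = h x

theorem measurable_shift (k : Fin d → ℤ) : Measurable (shift k : RField d → RField d) :=
  measurable_pi_lambda _ fun i => measurable_pi_apply (i + k)

theorem measurable_exIndGT (s : ℝ) (k : Fin d → ℤ) :
    Measurable (exIndGT s k : RField d → ℝ≥0∞) :=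
  Measurable.ite (measurableSet_lt measurable_const (measurable_pi_apply k).abs)
    measurable_const measurable_const

theorem shift_neg_shift (k : Fin d → ℤ) (x : RField d) : shift (-k) (shift k x) = x := by
  funext i
  simp [shift]

/-- For an anchoring function, `θ_{-k} x` is anchored at the origin and `-k` is an
exceedance-point of `x` iff `x` is anchored at `-k`. -/
theorem IsAnchoringOn.indicator_shift_mul_exIndGT {S : Set (RField d)}
    {A : RField d → Fin d → ℤ} (hA : IsAnchoringOn S A) {x : RField d} (hx : x ∈ S)
    (k : Fin d → ℤ) :
    {y | A y = 0}.indicator (1 : RField d → ℝ≥0∞) (shift (-k) x) * exIndGT 1 (-k) x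
      = {y | A y = -k}.indicator 1 x := by
  obtain ⟨hmem, hcov⟩ := hA.2 x hx
  by_cases hk : -k ∈ excSet x
  · have hk' : 1 < |x (-k)| := hk
    have hiff : A (shift (-k) x) = 0 ↔ A x = -k := by
      rw [← hcov _ hk, add_eq_right]
    simp [Set.indicator_apply, exIndGT, hk', hiff]
  · have hne : A x ≠ -k := fun h => hk (h ▸ hmem)
    have hk' : ¬ 1 < |x (-k)| := hk
    simp [Set.indicator_apply, exIndGT, hk', hne]

/-- The part of `E[h(Y)]` carried by the event that `Y` is anchored at `-k`. -/
theorem TailIdentity.lintegral_shift_anchored {Ω : Type*} [MeasurableSpace Ω] {μ : Measure Ω}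
    {Y : Ω → RField d} (hTI : TailIdentity μ Y) {S : Set (RField d)}
    (hS : ∀ᵐ ω ∂μ, Y ω ∈ S) {A : RField d → Fin d → ℤ} (hA : IsAnchoringOn S A)
    {h : RField d → ℝ≥0∞} (hh : Measurable h) (k : Fin d → ℤ) :
    ∫⁻ ω, {y | A y = 0}.indicator (fun x => h (shift k x) * exIndGT 1 k x) (Y ω) ∂μ
      = ∫⁻ ω, h (Y ω) * {y | A y = -k}.indicator 1 (Y ω) ∂μ := by
  have hA0 : MeasurableSet {y | A y = 0} := hA.1 (measurableSet_singleton 0)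
  have key := hTI
    (fun z => h z * {y | A y = 0}.indicator (1 : RField d → ℝ≥0∞) (shift (-k) z))
    (hh.mul ((measurable_one.indicator hA0).comp (measurable_shift (-k)))) k
  simp only [shift_neg_shift] at key
  calc _ = _ := lintegral_congr fun ω => by
          by_cases h0 : A (Y ω) = 0 <;> simp [h0]
    _ = _ := key
    _ = _ := lintegral_congr_ae <| by
          filter_upwards [hS] with ω hω
          rw [mul_assoc, hA.indicator_shift_mul_exIndGT hω]

theorem tsum_indicator_eq_neg {α G : Type*} [AddGroup G] (A : α → G) (x : α) :
    ∑' k : G, {y | A y = -k}.indicator (1 : α → ℝ≥0∞) x = 1 := by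
  rw [tsum_eq_single (-A x)]
  · simp
  · intro k hk
    have : A x ≠ -k := fun h => hk (by simp [h])
    simp [this]

/-- **Palm inversion formula.** Let `Y` satisfy the tail-process identity with
`P(Y ∈ E₀) = 1`, `A` an anchoring function, `ϑ_A = P(A(Y) = 0) > 0`, and let the anchored
process `Z^A` have law `P(Y ∈ · | A(Y) = 0)`. Then for every measurable `h ≥ 0`,
`E[h(Y)] = ϑ_A Σ_k E[h(θ_k Z^A) 1{|Z^A_k| > 1}] = ϑ_A E[Σ_{k∈e(Z^A)} h(θ_k Z^A)]`. -/
theorem palm_inversion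
    {Ω : Type*} [MeasurableSpace Ω] (μ : Measure Ω) [IsProbabilityMeasure μ]
    (Y : Ω → RField d) (hY : Measurable Y) (hTI : TailIdentity μ Y)
    (hE0 : ∀ᵐ ω ∂μ, Y ω ∈ E0set d)
    (A : RField d → Fin d → ℤ) (hA : IsAnchoringOn (E0set d) A)
    (hpos : 0 < μ {ω | A (Y ω) = 0}) :
    ∀ h : RField d → ℝ≥0∞, Measurable h →
      (∫⁻ ω, h (Y ω) ∂μ
          = μ {ω | A (Y ω) = 0} *
              ∑' k : Fin d → ℤ,
                ∫⁻ x, h (shift k x) * exIndGT 1 k x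
                  ∂(ProbabilityTheory.cond (Measure.map Y μ) {x | A x = 0})) ∧
      (∫⁻ ω, h (Y ω) ∂μ
          = μ {ω | A (Y ω) = 0} *
              ∫⁻ x, ∑' k : Fin d → ℤ, exIndGT 1 k x * h (shift k x)
                ∂(ProbabilityTheory.cond (Measure.map Y μ) {x | A x = 0})) := by
  intro h hh
  have hA0 : MeasurableSet {x | A x = 0} := hA.1 (measurableSet_singleton 0)
  have hmeas (k : Fin d → ℤ) : Measurable fun x : RField d => h (shift k x) * exIndGT 1 k x :=
    (hh.comp (measurable_shift k)).mul (measurable_exIndGT 1 k)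
  have hcond (k : Fin d → ℤ) : μ {ω | A (Y ω) = 0} *
      ∫⁻ x, h (shift k x) * exIndGT 1 k x ∂(cond (Measure.map Y μ) {x | A x = 0})
        = ∫⁻ ω, h (Y ω) * {y | A y = -k}.indicator 1 (Y ω) ∂μ := by
    have hmap : Measure.map Y μ {x | A x = 0} = μ {ω | A (Y ω) = 0} :=
      Measure.map_apply hY hA0
    rw [ProbabilityTheory.cond, lintegral_smul_measure, hmap, smul_eq_mul, ← mul_assoc,
      ENNReal.mul_inv_cancel hpos.ne' (measure_ne_top _ _), one_mul,
      ← lintegral_indicator hA0, lintegral_map ((hmeas k).indicator hA0) hY,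
      hTI.lintegral_shift_anchored hE0 hA hh]
  have hsum : ∫⁻ ω, h (Y ω) ∂μ = μ {ω | A (Y ω) = 0} * ∑' k : Fin d → ℤ,
      ∫⁻ x, h (shift k x) * exIndGT 1 k x ∂(cond (Measure.map Y μ) {x | A x = 0}) := by
    rw [← ENNReal.tsum_mul_left]
    simp_rw [hcond]
    have hterm (k : Fin d → ℤ) :
        Measurable fun ω => h (Y ω) * {y | A y = -k}.indicator (1 : RField d → ℝ≥0∞) (Y ω) :=
      (hh.comp hY).mul
        ((measurable_one.indicator (hA.1 (measurableSet_singleton (-k)))).comp hY)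
    rw [← lintegral_tsum fun k => (hterm k).aemeasurable]
    exact lintegral_congr fun ω => by
      rw [ENNReal.tsum_mul_left, tsum_indicator_eq_neg, mul_one]
  refine ⟨hsum, hsum.trans ?_⟩
  simp_rw [mul_comm (exIndGT 1 _ _)]
  rw [lintegral_tsum fun k => (hmeas k).aemeasurable]
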